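/- Let S ≥ 2 and v ≥ 2 be natural numbers, and define g : ℕ → ℤ by g(d) = d·(2S(v−1) − dv − v + 2). Then d* = S − 1 − ⌊(S−2)/v⌋ satisfies 1 ≤ d* ≤ S and g(d*) ≥ g(d) for every natural number d with 1 ≤ d ≤ S. -/

import Mathlib

theorem stmt14 (S v : ℕ) (hS : 2 ≤ S) (hv : 2 ≤ v)
    (g : ℕ → ℤ)
    (hg : ∀ d : ℕ, g d = (d:ℤ) * (2*(S:ℤ)*((v:ℤ)-1) - (d:ℤ)*(v:ℤ) - (v:ℤ) + 2))
    (dstar : ℕ) (hdstar : dstar = S - 1 - (S-2)/v) :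
    1 ≤ dstar ∧ dstar ≤ S ∧ ∀ d : ℕ, 1 ≤ d → d ≤ S → g d ≤ g dstar := by
  have hq : (S - 2) / v ≤ S - 2 := Nat.div_le_self _ _
  have hr : (S - 2) % v < v := Nat.mod_lt _ (by omega)
  have hdiv : v * ((S - 2) / v) + (S - 2) % v = S - 2 := Nat.div_add_mod _ _
  generalize (S - 2) / v = q at *
  generalize (S - 2) % v = r at *
  refine ⟨by omega, by omega, fun d _ _ => ?_⟩
  have hS' : (S : ℤ) = v * q + r + 2 := by
    have h : S = v * q + r + 2 := by omega
    exact_mod_cast h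
  have he : (dstar : ℤ) = S - 1 - q := by omega
  have hr' : (r : ℤ) + 1 ≤ v := by omega
  have key : g dstar - g d =
      ((dstar : ℤ) - d) * (v * ((dstar : ℤ) - d) + v - 2 * r - 2) := by
    rw [hg, hg, he, hS']
    ring
  suffices 0 ≤ g dstar - g d by linarith
  rw [key]
  generalize (dstar : ℤ) - d = n
  rcases lt_trichotomy n 0 with hn | rfl | hn
  · exact mul_nonneg_of_nonpos_of_nonpos hn.le (by nlinarith)
  · simp
  · exact mul_nonneg hn.le (by nlinarith)
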